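/- arXiv:2204.11038 — 4 statements merged into one kernel-verified Lean document; each statement's English description precedes it below -/
import Mathlib

section
/- For every x > 0 and every r ≥ 2√(p_G) + √(2x), ∫_{ℝ^p} 1{‖D_V u‖ > r} · e^{−‖D_G u‖²/2} du ≤ e^{−x − p_G/2} · Z. -/
open MeasureTheory Real Matrix

/-- `gaussNorm D u = ‖D u‖`, the Euclidean norm of the matrix `D` applied to `u`. -/
noncomputable def gaussNorm {p : ℕ} (D : Matrix (Fin p) (Fin p) ℝ)
    (u : EuclideanSpace ℝ (Fin p)) : ℝ :=
  ‖(Matrix.toEuclideanLin D) u‖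

theorem gaussNorm_sq {p : ℕ} (D : Matrix (Fin p) (Fin p) ℝ) (u : EuclideanSpace ℝ (Fin p)) :
    gaussNorm D u ^ 2 = u.ofLp ⬝ᵥ ((Dᴴ * D) *ᵥ u.ofLp) := by
  unfold gaussNorm
  rw [← real_inner_self_eq_norm_sq, EuclideanSpace.inner_eq_star_dotProduct]
  simp [toLpLin_apply, ← mulVec_mulVec, dotProduct_mulVec, vecMul_transpose]

theorem gauss_integrable (p : ℕ) :
    Integrable (fun u : EuclideanSpace ℝ (Fin p) => exp (-‖u‖ ^ 2 / 2)) := by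
  have h := GaussianFourier.integrable_cexp_neg_mul_sq_norm_add
    (V := EuclideanSpace ℝ (Fin p)) (b := (1/2 : ℂ)) (by norm_num) 0 0
  have h2 := h.norm
  refine h2.congr (Filter.Eventually.of_forall fun u => ?_)
  simp only [Complex.norm_exp]
  congr 1
  simp [← Complex.ofReal_pow]
  ring

theorem gauss_comp {p : ℕ} (B : Matrix (Fin p) (Fin p) ℝ) (hB : B.det ≠ 0) :
    Integrable (fun u : EuclideanSpace ℝ (Fin p) => exp (-(gaussNorm B u) ^ 2 / 2)) ∧
    ∫ u : EuclideanSpace ℝ (Fin p), exp (-(gaussNorm B u) ^ 2 / 2) =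
      |B.det|⁻¹ * ∫ u : EuclideanSpace ℝ (Fin p), exp (-‖u‖ ^ 2 / 2) := by
  have hd : LinearMap.det (Matrix.toEuclideanLin B) = B.det := LinearMap.det_toLpLin _ _
  have hmap := Measure.map_linearMap_addHaar_eq_smul_addHaar
    (volume : Measure (EuclideanSpace ℝ (Fin p))) (f := Matrix.toEuclideanLin B) (by rwa [hd])
  have hc : Continuous (Matrix.toEuclideanLin B) := LinearMap.continuous_of_finiteDimensional _
  have hi := gauss_integrable p
  have hi2 : Integrable (fun u : EuclideanSpace ℝ (Fin p) => exp (-‖u‖ ^ 2 / 2))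
      (Measure.map (Matrix.toEuclideanLin B) volume) := by
    rw [hmap]
    exact hi.smul_measure ENNReal.ofReal_ne_top
  refine ⟨hi2.comp_measurable hc.measurable, ?_⟩
  have := integral_map hc.measurable.aemeasurable hi2.aestronglyMeasurable
  unfold gaussNorm
  rw [← this, hmap, integral_smul_measure, hd, abs_inv,
    ENNReal.toReal_ofReal (by positivity), smul_eq_mul]

theorem det_bound {p : ℕ} (M : Matrix (Fin p) (Fin p) ℝ) (hM : M.PosSemidef)
    (hM1 : (1 - M).PosSemidef) (μ : ℝ) (h0 : 0 ≤ μ) (h1 : μ < 1) :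
    (1 - μ) ^ M.trace ≤ (1 - μ • M).det := by
  set l := hM.1.eigenvalues with hl
  have hl0 : ∀ i, 0 ≤ l i := hM.eigenvalues_nonneg
  have hl1 : ∀ i, l i ≤ 1 := by
    intro i
    have h := hM1.dotProduct_mulVec_nonneg (hM.1.eigenvectorBasis i).ofLp
    have hn : star (hM.1.eigenvectorBasis i).ofLp ⬝ᵥ (hM.1.eigenvectorBasis i).ofLp = 1 := by
      rw [dotProduct_comm, ← EuclideanSpace.inner_eq_star_dotProduct, real_inner_self_eq_norm_sq,
        hM.1.eigenvectorBasis.orthonormal.1 i]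
      norm_num
    rw [sub_mulVec, one_mulVec, hM.1.mulVec_eigenvectorBasis, dotProduct_sub, dotProduct_smul, hn]
      at h
    simpa using h
  have hdet : (1 - μ • M).det = ∏ i, (1 - μ * l i) := by
    have h := hM.1.spectral_theorem
    rw [Unitary.conjStarAlgAut_apply] at h
    set U : Matrix (Fin p) (Fin p) ℝ := (hM.1.eigenvectorUnitary : Matrix (Fin p) (Fin p) ℝ)
    have hU : U * star U = 1 := Unitary.coe_mul_star_self _
    have : 1 - μ • M = U * diagonal (fun i => 1 - μ * l i) * star U := by
      have e : (diagonal (fun i => 1 - μ * l i) : Matrix (Fin p) (Fin p) ℝ)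
          = 1 - μ • diagonal (RCLike.ofReal ∘ l) := by
        ext i j
        by_cases hij : i = j
        · subst hij; simp
        · simp [hij]
      rw [e, mul_sub, sub_mul, mul_one, hU, Matrix.mul_smul, Matrix.smul_mul, ← h]
    have hUd : U.det * (star U).det = 1 := by rw [← det_mul, hU, det_one]
    rw [this, det_mul, det_mul, det_diagonal, mul_right_comm, hUd, one_mul]
  rw [hdet, hM.1.trace_eq_sum_eigenvalues]
  simp only [RCLike.ofReal_real_eq_id, id]
  rw [Real.rpow_sum_of_pos (by linarith)]
  refine Finset.prod_le_prod (fun i _ => (Real.rpow_pos_of_pos (by linarith) _).le) fun i _ => ?_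
  have := rpow_one_add_le_one_add_mul_self (s := -μ) (by linarith) (hl0 i) (hl1 i)
  rw [← sub_eq_add_neg] at this
  linarith

open scoped MatrixOrder in
theorem psd_factor {p : ℕ} {A : Matrix (Fin p) (Fin p) ℝ} (hA : A.PosSemidef) :
    ∃ B : Matrix (Fin p) (Fin p) ℝ, A = Bᴴ * B := by
  obtain ⟨B, hB⟩ := CStarAlgebra.nonneg_iff_eq_star_mul_self.mp hA.nonneg
  exact ⟨B, hB⟩

theorem scalar_bound (q x r : ℝ) (hq : 0 < q) (hx : 0 < x)
    (hr : 2 * √q + √(2 * x) ≤ r) :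
    0 ≤ 1 - q / r ^ 2 ∧ 1 - q / r ^ 2 < 1 ∧
    exp (-(1 - q / r ^ 2) * r ^ 2 / 2) * ((1 - (1 - q / r ^ 2)) ^ (q / 2))⁻¹
      ≤ exp (-x - q / 2) := by
  have ha : 0 < √q := Real.sqrt_pos.2 hq
  have ha2 : √q ^ 2 = q := Real.sq_sqrt hq.le
  have hs : 0 ≤ √(2 * x) := Real.sqrt_nonneg _
  have hs2 : √(2 * x) ^ 2 = 2 * x := Real.sq_sqrt (by positivity)
  set a := √q
  set s := √(2 * x)
  have hr0 : 0 < r := by linarith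
  refine ⟨?_, ?_, ?_⟩
  · rw [sub_nonneg, div_le_one (by positivity)]; nlinarith
  · have : 0 < q / r ^ 2 := by positivity
    linarith
  · have e : 1 - (1 - q / r ^ 2) = (r / a) ^ (-2 : ℝ) := by
      rw [Real.rpow_neg (by positivity), Real.rpow_two, ← ha2]; field_simp; ring
    have hlog : log (r / a) ≤ r / a - 1 := Real.log_le_sub_one_of_pos (by positivity)
    rw [e, ← Real.rpow_mul (by positivity), ← Real.rpow_neg (by positivity),
      Real.rpow_def_of_pos (by positivity), ← Real.exp_add]
    apply Real.exp_le_exp.2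
    have e2 : (1 - q / r ^ 2) * r ^ 2 = r ^ 2 - q := by field_simp
    have e3 : q * (r / a) = a * r := by rw [← ha2]; field_simp
    have := mul_le_mul_of_nonneg_left hlog hq.le
    nlinarith [mul_self_le_mul_self (by positivity : 0 ≤ a + s) (by linarith : a + s ≤ r - a),
      mul_nonneg ha.le hs]

theorem stmt_13 (p : ℕ)
    (DG DV : Matrix (Fin p) (Fin p) ℝ) (hDG : DG.PosDef) (hDV : DV.PosDef)
    (hLoewner : (DG * DG - DV * DV).PosSemidef)
    (pG Z : ℝ) (hpG : pG = ((DV * DV) * (DG * DG)⁻¹).trace)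
    (hZ : Z = ∫ u : EuclideanSpace ℝ (Fin p), exp (-(gaussNorm DG u) ^ 2 / 2)) :
    ∀ x : ℝ, 0 < x → ∀ r : ℝ, 2 * Real.sqrt pG + Real.sqrt (2 * x) ≤ r →
      (∫ u in {u : EuclideanSpace ℝ (Fin p) | r < gaussNorm DV u},
          exp (-(gaussNorm DG u) ^ 2 / 2)) ≤ exp (-x - pG / 2) * Z := by
  intro x hx r hr
  have hZ0 : 0 ≤ Z := by rw [hZ]; exact integral_nonneg fun u => (exp_pos _).le
  have hr0 : 0 < r := by
    have h1 := Real.sqrt_pos.2 (by positivity : 0 < 2 * x)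
    have h2 := Real.sqrt_nonneg pG
    linarith
  rcases Nat.eq_zero_or_pos p with hp | hp
  · subst hp
    have : {u : EuclideanSpace ℝ (Fin 0) | r < gaussNorm DV u} = ∅ := by
      ext u
      simp [gaussNorm, Subsingleton.elim ((Matrix.toEuclideanLin DV) u) 0, hr0.le]
    rw [this, setIntegral_empty]
    positivity
  haveI : Nonempty (Fin p) := ⟨⟨0, hp⟩⟩
  have hGd : DG.det ≠ 0 := hDG.det_pos.ne'
  have hGu : IsUnit DG.det := hGd.isUnit
  have hGH : DGᴴ = DG := hDG.1
  have hVH : DVᴴ = DV := hDV.1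
  have hGiH : DG⁻¹ᴴ = DG⁻¹ := hDG.1.inv
  set M := DG⁻¹ * (DV * DV) * DG⁻¹ with hMdef
  have hVV : (DV * DV).PosDef := by
    have := Matrix.PosDef.conjTranspose_mul_self DV
      (mulVec_injective_of_isUnit hDV.isUnit)
    rwa [hVH] at this
  have hMp : M.PosDef := by
    have := hVV.conjTranspose_mul_mul_same (B := DG⁻¹)
      (mulVec_injective_of_isUnit hDG.inv.isUnit)
    rwa [hGiH] at this
  have hM1 : (1 - M).PosSemidef := by
    have := hLoewner.conjTranspose_mul_mul_same DG⁻¹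
    rw [hGiH, mul_sub, sub_mul, ← mul_assoc, nonsing_inv_mul _ hGu, one_mul,
      mul_nonsing_inv _ hGu] at this
    exact this
  have htr : M.trace = pG := by
    rw [hpG, hMdef, mul_assoc, trace_mul_comm, mul_assoc, Matrix.mul_inv_rev]
  have hq : 0 < pG := by rw [← htr]; exact hMp.trace_pos
  obtain ⟨hμ0, hμ1, hfin⟩ := scalar_bound pG x r hq hx hr
  set μ := 1 - pG / r ^ 2
  have hA : (DG * DG - μ • (DV * DV)).PosSemidef := by
    have hGG : (DG * DG).PosSemidef := by
      have := Matrix.posSemidef_conjTranspose_mul_self DG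
      rwa [hGH] at this
    have := (hGG.smul (by linarith : 0 ≤ 1 - μ)).add (hLoewner.smul hμ0)
    convert this using 1
    module
  have hAe : DG * DG - μ • (DV * DV) = DG * (1 - μ • M) * DG := by
    have : DG * M * DG = DV * DV := by
      rw [hMdef, ← mul_assoc, ← mul_assoc, mul_nonsing_inv _ hGu, one_mul, mul_assoc,
        nonsing_inv_mul _ hGu, mul_one]
    rw [mul_sub, sub_mul, mul_one, Matrix.mul_smul, Matrix.smul_mul, this]
  obtain ⟨B, hB⟩ : ∃ B : Matrix (Fin p) (Fin p) ℝ, DG * DG - μ • (DV * DV) = Bᴴ * B := psd_factor hA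
  have hdb := det_bound M hMp.posSemidef hM1 μ hμ0 hμ1
  rw [htr] at hdb
  have hpos : 0 < 1 - μ := by linarith
  have hdet : B.det ^ 2 = DG.det ^ 2 * (1 - μ • M).det := by
    have := congrArg Matrix.det hB
    rw [hAe, det_mul, det_mul, det_mul, det_conjTranspose] at this
    simp only [star_trivial] at this
    linarith
  have hge : (1 - μ) ^ (pG / 2) * |DG.det| ≤ |B.det| := by
    refine (sq_le_sq₀ (by positivity) (abs_nonneg _)).1 ?_
    rw [mul_pow, sq_abs, sq_abs, hdet, mul_comm]
    gcongr
    rw [← Real.rpow_natCast, ← Real.rpow_mul hpos.le]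
    simpa using hdb
  have hw : 0 < (1 - μ) ^ (pG / 2) := Real.rpow_pos_of_pos hpos _
  have hBd : B.det ≠ 0 := by
    rw [← abs_pos]
    exact lt_of_lt_of_le (by positivity) hge
  obtain ⟨hBi, hBint⟩ := gauss_comp B hBd
  obtain ⟨hGi, hGint⟩ := gauss_comp DG hGd
  have hsq : ∀ u, gaussNorm B u ^ 2 = gaussNorm DG u ^ 2 - μ * gaussNorm DV u ^ 2 := by
    intro u
    rw [gaussNorm_sq, gaussNorm_sq, gaussNorm_sq, ← hB, hGH, hVH, sub_mulVec, dotProduct_sub,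
      smul_mulVec, dotProduct_smul, smul_eq_mul]
  have hVc : Continuous (fun u => gaussNorm DV u) :=
    (LinearMap.continuous_of_finiteDimensional (Matrix.toEuclideanLin DV)).norm
  have hms : MeasurableSet {u : EuclideanSpace ℝ (Fin p) | r < gaussNorm DV u} :=
    measurableSet_lt measurable_const hVc.measurable
  set c := ∫ u : EuclideanSpace ℝ (Fin p), exp (-‖u‖ ^ 2 / 2) with hc
  have hc0 : 0 ≤ c := integral_nonneg fun u => (exp_pos _).le
  rw [← hZ] at hGint
  calc (∫ u in {u : EuclideanSpace ℝ (Fin p) | r < gaussNorm DV u},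
          exp (-(gaussNorm DG u) ^ 2 / 2))
      ≤ ∫ u in {u : EuclideanSpace ℝ (Fin p) | r < gaussNorm DV u},
          exp (-μ * r ^ 2 / 2) * exp (-(gaussNorm B u) ^ 2 / 2) := by
        refine setIntegral_mono_on hGi.integrableOn (hBi.const_mul _).integrableOn hms ?_
        intro u hu
        have hu' : r < gaussNorm DV u := hu
        rw [← Real.exp_add, hsq]
        apply Real.exp_le_exp.2
        have : r ^ 2 ≤ gaussNorm DV u ^ 2 := by gcongr
        nlinarith
    _ ≤ ∫ u, exp (-μ * r ^ 2 / 2) * exp (-(gaussNorm B u) ^ 2 / 2) :=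
        setIntegral_le_integral (hBi.const_mul _)
          (Filter.Eventually.of_forall fun u => by positivity)
    _ = exp (-μ * r ^ 2 / 2) * (|B.det|⁻¹ * c) := by rw [integral_const_mul, hBint]
    _ ≤ exp (-μ * r ^ 2 / 2) * (((1 - μ) ^ (pG / 2) * |DG.det|)⁻¹ * c) := by
        gcongr
    _ = exp (-μ * r ^ 2 / 2) * ((1 - μ) ^ (pG / 2))⁻¹ * Z := by
        rw [hGint, mul_inv]; ring
    _ ≤ exp (-x - pG / 2) * Z := by gcongr
end

section
/- Under the stated assumptions with ω ≤ 1/3: (i) ∫_U e^{F(u)} du ≥ e^{−ω·p_G/2} · ∫_U e^{−‖D_G u‖²/2} du, and (ii) (∫_{Uᶜ} e^{F(u)} du)/(∫_{ℝ^p} e^{F(u)} du) ≤ 4·e^{−x − (1−ω)p_G/2}. -/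
open MeasureTheory Real Matrix

theorem aux_gn_sq {p : ℕ} (D : Matrix (Fin p) (Fin p) ℝ) (u : EuclideanSpace ℝ (Fin p)) :
    gaussNorm D u ^ 2 = u.ofLp ⬝ᵥ ((Dᵀ * D) *ᵥ u.ofLp) := by
  unfold gaussNorm
  rw [EuclideanSpace.real_norm_sq_eq]
  rw [← Matrix.mulVec_mulVec, Matrix.dotProduct_mulVec, Matrix.vecMul_transpose]
  simp [dotProduct, sq]

theorem aux_diag_mat {p : ℕ} (DG DV : Matrix (Fin p) (Fin p) ℝ) (hDG : DG.PosDef)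
    (hDV : DV.PosDef) :
    ∃ (W : Matrix (Fin p) (Fin p) ℝ) (b : Fin p → ℝ), IsUnit W.det ∧ Wᵀ * W = DG * DG ∧
      Wᵀ * diagonal b * W = DV * DV ∧ ∑ i, b i = ((DV * DV) * (DG * DG)⁻¹).trace := by
  have hGu : IsUnit DG.det := hDG.det_pos.ne'.isUnit
  have hGt : DGᵀ = DG := by simpa using hDG.isHermitian.eq
  have hVt : DVᵀ = DV := by simpa using hDV.isHermitian.eq
  have hH : (DG⁻¹ * (DV * DV) * DG⁻¹).IsHermitian := by
    rw [Matrix.IsHermitian]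
    simp [Matrix.conjTranspose_eq_transpose_of_trivial, Matrix.transpose_mul,
      Matrix.transpose_nonsing_inv, hGt, hVt, Matrix.mul_assoc]
  set O : Matrix (Fin p) (Fin p) ℝ := (hH.eigenvectorUnitary : Matrix (Fin p) (Fin p) ℝ) with hO
  have h1 : O * Oᵀ = 1 := by
    simpa [Matrix.star_eq_conjTranspose] using Unitary.mul_star_self_of_mem hH.eigenvectorUnitary.2
  have h2 : Oᵀ * O = 1 := mul_eq_one_comm.mp h1
  have hs : DG⁻¹ * (DV * DV) * DG⁻¹ = O * diagonal hH.eigenvalues * Oᵀ := by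
    have := hH.spectral_theorem
    rw [Unitary.conjStarAlgAut_apply] at this
    simpa [Matrix.star_eq_conjTranspose] using this
  refine ⟨Oᵀ * DG, hH.eigenvalues, ?_, ?_, ?_, ?_⟩
  · rw [Matrix.det_mul]
    refine IsUnit.mul ?_ hGu
    exact (Matrix.isUnit_iff_isUnit_det _).mp (IsUnit.of_mul_eq_one _ h2)
  · rw [Matrix.transpose_mul, hGt, Matrix.transpose_transpose]
    calc DG * O * (Oᵀ * DG) = DG * (O * Oᵀ) * DG := by simp only [Matrix.mul_assoc]
      _ = _ := by rw [h1, Matrix.mul_one]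
  · rw [Matrix.transpose_mul, hGt, Matrix.transpose_transpose]
    calc DG * O * diagonal hH.eigenvalues * (Oᵀ * DG)
        = DG * (O * diagonal hH.eigenvalues * Oᵀ) * DG := by simp only [Matrix.mul_assoc]
      _ = (DG * DG⁻¹) * (DV * DV) * (DG⁻¹ * DG) := by rw [← hs]; simp only [Matrix.mul_assoc]
      _ = _ := by rw [Matrix.mul_nonsing_inv _ hGu, Matrix.nonsing_inv_mul _ hGu]; simp
  · have := congrArg Matrix.trace hs
    have h4 : (O * diagonal hH.eigenvalues * Oᵀ).trace = ∑ i, hH.eigenvalues i := by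
      rw [Matrix.trace_mul_comm (O * diagonal hH.eigenvalues) Oᵀ,
        ← Matrix.mul_assoc Oᵀ O, h2, Matrix.one_mul, Matrix.trace_diagonal]
    rw [h4] at this
    rw [← this, Matrix.mul_inv_rev, Matrix.mul_assoc DG⁻¹, Matrix.trace_mul_comm DG⁻¹, Matrix.mul_assoc (DV * DV)]

theorem aux_diag {p : ℕ} (DG DV : Matrix (Fin p) (Fin p) ℝ) (hDG : DG.PosDef)
    (hDV : DV.PosDef) (hLoewner : (DG * DG - DV * DV).PosSemidef) :
    ∃ (L : EuclideanSpace ℝ (Fin p) ≃L[ℝ] (Fin p → ℝ)) (b : Fin p → ℝ),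
      (∀ u, gaussNorm DG u ^ 2 = ∑ i, (L u i) ^ 2) ∧
      (∀ u, gaussNorm DV u ^ 2 = ∑ i, b i * (L u i) ^ 2) ∧
      (∀ i, 0 < b i) ∧ (∀ i, b i ≤ 1) ∧ ∑ i, b i = ((DV * DV) * (DG * DG)⁻¹).trace := by
  obtain ⟨W, b, hW, h1, h2, h3⟩ := aux_diag_mat DG DV hDG hDV
  have hGt : DGᵀ = DG := by simpa using hDG.isHermitian.eq
  have hVt : DVᵀ = DV := by simpa using hDV.isHermitian.eq
  let L : EuclideanSpace ℝ (Fin p) ≃L[ℝ] (Fin p → ℝ) :=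
    ((WithLp.linearEquiv 2 ℝ (Fin p → ℝ)).trans
      (Matrix.toLin'OfInv (Matrix.nonsing_inv_mul W hW) (Matrix.mul_nonsing_inv W hW)
        )).toContinuousLinearEquiv
  have hL : ∀ u, L u = W *ᵥ u.ofLp := by
    intro u
    simp [L]
    rfl
  have hG : ∀ u, gaussNorm DG u ^ 2 = ∑ i, (L u i) ^ 2 := by
    intro u
    rw [aux_gn_sq, hGt, ← h1, ← Matrix.mulVec_mulVec, Matrix.dotProduct_mulVec,
      Matrix.vecMul_transpose, hL]
    simp [dotProduct, sq]
  have hV : ∀ u, gaussNorm DV u ^ 2 = ∑ i, b i * (L u i) ^ 2 := by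
    intro u
    rw [aux_gn_sq, hVt, ← h2, ← Matrix.mulVec_mulVec, ← Matrix.mulVec_mulVec,
      Matrix.dotProduct_mulVec, Matrix.vecMul_transpose, hL]
    simp only [dotProduct, sq, Matrix.mulVec_diagonal]
    exact Finset.sum_congr rfl fun i _ => by ring
  have hle : ∀ u, gaussNorm DV u ^ 2 ≤ gaussNorm DG u ^ 2 := by
    intro u
    rw [aux_gn_sq, aux_gn_sq, hGt, hVt]
    have := hLoewner.dotProduct_mulVec_nonneg u.ofLp
    simp [Matrix.sub_mulVec, dotProduct_sub] at this
    linarith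
  have e1 : ∀ i, ∑ j, (L (L.symm (Pi.single i 1)) j) ^ 2 = 1 := by
    intro i
    simp [Pi.single_apply]
  have e2 : ∀ i, ∑ j, b j * (L (L.symm (Pi.single i 1)) j) ^ 2 = b i := by
    intro i
    simp [Pi.single_apply]
  refine ⟨L, b, hG, hV, ?_, ?_, h3⟩
  · intro i
    rw [← e2 i, ← hV, aux_gn_sq, hVt]
    have hne : (L.symm (Pi.single i 1)).ofLp ≠ 0 := by
      intro h
      have h' : L.symm (Pi.single i 1) = 0 := by ext j; simp [h]
      have := e1 i
      rw [h'] at this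
      simp at this
    have hp : (DV * DV).PosDef := by
      have := hDV.isUnit
      have h5 := Matrix.PosDef.conjTranspose_mul_self DV (Matrix.mulVec_injective_iff_isUnit.mpr this)
      simpa [hVt] using h5
    simpa using hp.dotProduct_mulVec_pos hne
  · intro i
    have := hle (L.symm (Pi.single i 1))
    rw [hV, hG, e1, e2] at this
    exact this

theorem aux_change {p : ℕ} (L : EuclideanSpace ℝ (Fin p) ≃L[ℝ] (Fin p → ℝ)) :
    ∃ K : ℝ, 0 < K ∧ (∀ g : (Fin p → ℝ) → ℝ, ∫ u, g (L u) = K * ∫ v, g v) ∧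
      (∀ g : (Fin p → ℝ) → ℝ, Integrable g → Integrable (fun u => g (L u))) := by
  have hm : MeasurableEmbedding L := L.toHomeomorph.measurableEmbedding
  have hc := Measure.isAddLeftInvariant_eq_smul (Measure.map L volume) (volume : Measure (Fin p → ℝ))
  set c := Measure.addHaarScalarFactor (Measure.map L volume) (volume : Measure (Fin p → ℝ)) with hcd
  have hcpos : 0 < c := Measure.addHaarScalarFactor_pos_of_isAddHaarMeasure _ _
  refine ⟨c, by exact_mod_cast hcpos, ?_, ?_⟩
  · intro g
    rw [← hm.integral_map, hc, integral_smul_nnreal_measure]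
    rfl
  · intro g hg
    have : Integrable g (Measure.map L volume) := by
      rw [hc]
      exact hg.smul_measure_nnreal
    exact (hm.integrable_map_iff).mp this

theorem aux_1d_int {a : ℝ} (ha : 0 < a) : Integrable (fun x : ℝ => exp (-(a * x ^ 2 / 2))) := by
  have := integrable_exp_neg_mul_sq (b := a / 2) (by positivity)
  refine this.congr (Filter.Eventually.of_forall fun x => ?_)
  simp only; congr 1; ring

theorem aux_1d_val (a : ℝ) : ∫ x : ℝ, exp (-(a * x ^ 2 / 2)) = √(2 * π / a) := by
  have := integral_gaussian (a / 2)
  rw [show 2 * π / a = π / (a / 2) by field_simp, ← this]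
  congr 1; ext x; congr 1; ring

theorem aux_1d_sq_int : Integrable (fun x : ℝ => x ^ 2 * exp (-(x ^ 2 / 2))) := by
  have := integrable_rpow_mul_exp_neg_mul_sq (b := 1 / 2) (by positivity) (s := 2) (by norm_num)
  refine this.congr (Filter.Eventually.of_forall fun x => ?_)
  simp only [Real.rpow_two]; congr 2; ring

theorem aux_1d_sq_val : ∫ x : ℝ, x ^ 2 * exp (-(x ^ 2 / 2)) = √(2 * π) := by
  have h := ProbabilityTheory.variance_fun_id_gaussianReal (μ := 0) (v := 1)
  rw [ProbabilityTheory.variance_eq_integral (by fun_prop)] at h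
  simp only [ProbabilityTheory.integral_id_gaussianReal] at h
  rw [ProbabilityTheory.integral_gaussianReal_eq_integral_smul one_ne_zero] at h
  simp only [ProbabilityTheory.gaussianPDFReal, smul_eq_mul, sub_zero, NNReal.coe_one, mul_one] at h
  have hpos : 0 < √(2 * π) := by positivity
  have h2 : ∫ x : ℝ, (√(2 * π))⁻¹ * exp (-x ^ 2 / 2) * x ^ 2
      = (√(2 * π))⁻¹ * ∫ x : ℝ, x ^ 2 * exp (-(x ^ 2 / 2)) := by
    rw [← integral_const_mul]
    congr 1; ext x
    rw [neg_div]; ring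
  rw [h2] at h
  field_simp at h
  exact h

theorem aux_factor {b μ : ℝ} (hb0 : 0 ≤ b) (hb1 : b ≤ 1) (hμ : 0 < μ) :
    √(2 * π / (1 - (1 - μ) * b)) ≤ √(2 * π / 1) * μ ^ (-(b / 2)) := by
  have h := Real.geom_mean_le_arith_mean2_weighted (w₁ := 1 - b) (w₂ := b) (p₁ := 1) (p₂ := μ)
    (by linarith) hb0 zero_le_one hμ.le (by ring)
  rw [Real.one_rpow, one_mul] at h
  have hpos : 0 < μ ^ b := Real.rpow_pos_of_pos hμ _
  have e : μ ^ (-(b / 2)) = √((μ ^ b)⁻¹) := by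
    rw [Real.sqrt_eq_rpow, ← Real.rpow_neg hμ.le, ← Real.rpow_mul hμ.le]
    congr 1; ring
  rw [e, ← Real.sqrt_mul (by positivity)]
  apply Real.sqrt_le_sqrt
  rw [div_one, ← div_eq_mul_inv]
  apply div_le_div_of_nonneg_left (by positivity) hpos
  linarith

theorem aux_pi {p : ℕ} (b : Fin p → ℝ) (hb0 : ∀ i, 0 < b i) (hb1 : ∀ i, b i ≤ 1)
    {μ : ℝ} (hμ : 0 < μ) :
    Integrable (fun v : Fin p → ℝ =>
      exp (-(∑ i, v i ^ 2) / 2 + (1 - μ) * (∑ i, b i * v i ^ 2) / 2)) ∧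
    ∫ v : Fin p → ℝ, exp (-(∑ i, v i ^ 2) / 2 + (1 - μ) * (∑ i, b i * v i ^ 2) / 2) ≤
      μ ^ (-((∑ i, b i) / 2)) * ∫ v : Fin p → ℝ, exp (-(∑ i, v i ^ 2) / 2) := by
  have e : (fun v : Fin p → ℝ =>
      exp (-(∑ i, v i ^ 2) / 2 + (1 - μ) * (∑ i, b i * v i ^ 2) / 2)) =
      fun v => ∏ i, exp (-((1 - (1 - μ) * b i) * v i ^ 2 / 2)) := by
    ext v
    rw [← Real.exp_sum]
    congr 1
    rw [Finset.mul_sum, ← Finset.sum_neg_distrib, Finset.sum_div, Finset.sum_div,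
      ← Finset.sum_add_distrib]
    exact Finset.sum_congr rfl fun i _ => by ring
  have e0 : (fun v : Fin p → ℝ => exp (-(∑ i, v i ^ 2) / 2)) =
      fun v => ∏ i, exp (-(1 * v i ^ 2 / 2)) := by
    ext v
    rw [← Real.exp_sum]
    congr 1
    rw [← Finset.sum_neg_distrib, Finset.sum_div]
    exact Finset.sum_congr rfl fun i _ => by ring
  have hpos : ∀ i, 0 < 1 - (1 - μ) * b i := by
    intro i
    nlinarith [hb0 i, hb1 i, mul_pos hμ (hb0 i)]
  constructor
  · rw [e]
    exact Integrable.fintype_prod (f := fun i x => exp (-((1 - (1 - μ) * b i) * x ^ 2 / 2)))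
      (fun i => aux_1d_int (hpos i))
  · rw [e, e0]
    rw [integral_fintype_prod_volume_eq_prod
        (f := fun i x => exp (-((1 - (1 - μ) * b i) * x ^ 2 / 2))),
      integral_fintype_prod_volume_eq_prod (f := fun i x => exp (-(1 * x ^ 2 / 2)))]
    simp only [aux_1d_val]
    rw [show -((∑ i, b i) / 2) = ∑ i, (-(b i / 2)) by
      rw [Finset.sum_neg_distrib, Finset.sum_div], Real.rpow_sum_of_pos hμ,
      ← Finset.prod_mul_distrib]
    apply Finset.prod_le_prod
    · intro i _; positivity
    · intro i _
      rw [mul_comm (μ ^ _)]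
      exact aux_factor (hb0 i).le (hb1 i) hμ

theorem aux_pi_sq {p : ℕ} (b : Fin p → ℝ) :
    Integrable (fun v : Fin p → ℝ => (∑ i, b i * v i ^ 2) * exp (-(∑ i, v i ^ 2) / 2)) ∧
    ∫ v : Fin p → ℝ, (∑ i, b i * v i ^ 2) * exp (-(∑ i, v i ^ 2) / 2) =
      (∑ i, b i) * ∫ v : Fin p → ℝ, exp (-(∑ i, v i ^ 2) / 2) := by
  have e0 : (fun v : Fin p → ℝ => exp (-(∑ i, v i ^ 2) / 2)) =
      fun v => ∏ i, exp (-(v i ^ 2 / 2)) := by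
    ext v
    rw [← Real.exp_sum]
    congr 1
    rw [← Finset.sum_neg_distrib, Finset.sum_div]
    exact Finset.sum_congr rfl fun i _ => by ring
  let f : Fin p → Fin p → ℝ → ℝ := fun i j x => (if j = i then x ^ 2 else 1) * exp (-(x ^ 2 / 2))
  have ef : ∀ i, ∀ v : Fin p → ℝ, v i ^ 2 * exp (-(∑ i, v i ^ 2) / 2) = ∏ j, f i j (v j) := by
    intro i v
    rw [congrFun e0 v]
    simp only [f, Finset.prod_mul_distrib]
    simp
  have i1 : Integrable (fun x : ℝ => exp (-(x ^ 2 / 2))) := by simpa using aux_1d_int one_pos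
  have v1 : ∫ x : ℝ, exp (-(x ^ 2 / 2)) = √(2 * π) := by simpa using aux_1d_val 1
  have hfi : ∀ i j, Integrable (f i j) := by
    intro i j
    by_cases h : j = i
    · simpa [f, h] using aux_1d_sq_int
    · simpa [f, h] using i1
  have hfv : ∀ i j, ∫ x, f i j x = √(2 * π) := by
    intro i j
    by_cases h : j = i
    · simpa [f, h] using aux_1d_sq_val
    · simpa [f, h] using v1
  have hI : ∀ i, Integrable (fun v : Fin p → ℝ => v i ^ 2 * exp (-(∑ i, v i ^ 2) / 2)) := by
    intro i
    simp only [ef]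
    exact Integrable.fintype_prod (f := f i) (hfi i)
  have hV : ∀ i, ∫ v : Fin p → ℝ, v i ^ 2 * exp (-(∑ i, v i ^ 2) / 2) =
      ∫ v : Fin p → ℝ, exp (-(∑ i, v i ^ 2) / 2) := by
    intro i
    simp only [ef]
    rw [e0, integral_fintype_prod_volume_eq_prod (f := f i),
      integral_fintype_prod_volume_eq_prod (f := fun i x => exp (-(x ^ 2 / 2)))]
    simp only [hfv, v1]
  have es : (fun v : Fin p → ℝ => (∑ i, b i * v i ^ 2) * exp (-(∑ i, v i ^ 2) / 2)) =
      fun v => ∑ i, b i * (v i ^ 2 * exp (-(∑ i, v i ^ 2) / 2)) := by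
    ext v
    rw [Finset.sum_mul]
    exact Finset.sum_congr rfl fun i _ => by ring
  rw [es]
  constructor
  · exact integrable_finsetSum _ fun i _ => (hI i).const_mul _
  · rw [integral_finsetSum _ fun i _ => (hI i).const_mul _, Finset.sum_mul]
    refine Finset.sum_congr rfl fun i _ => ?_
    rw [integral_const_mul, hV]

/-- All Gaussian facts needed. -/
theorem aux_gauss {p : ℕ} (DG DV : Matrix (Fin p) (Fin p) ℝ) (hDG : DG.PosDef)
    (hDV : DV.PosDef) (hLoewner : (DG * DG - DV * DV).PosSemidef) (pG : ℝ)
    (hpG : pG = ((DV * DV) * (DG * DG)⁻¹).trace) :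
    (0 < p → 0 < pG) ∧ 0 ≤ pG ∧
    Integrable (fun u : EuclideanSpace ℝ (Fin p) => exp (-(gaussNorm DG u) ^ 2 / 2)) ∧
    0 < ∫ u : EuclideanSpace ℝ (Fin p), exp (-(gaussNorm DG u) ^ 2 / 2) ∧
    (∀ μ : ℝ, 0 < μ → Integrable (fun u : EuclideanSpace ℝ (Fin p) =>
        exp (-(gaussNorm DG u) ^ 2 / 2 + (1 - μ) * (gaussNorm DV u) ^ 2 / 2)) ∧
      ∫ u : EuclideanSpace ℝ (Fin p),
        exp (-(gaussNorm DG u) ^ 2 / 2 + (1 - μ) * (gaussNorm DV u) ^ 2 / 2) ≤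
        μ ^ (-(pG / 2)) * ∫ u : EuclideanSpace ℝ (Fin p), exp (-(gaussNorm DG u) ^ 2 / 2)) ∧
    Integrable (fun u : EuclideanSpace ℝ (Fin p) =>
      (gaussNorm DV u) ^ 2 * exp (-(gaussNorm DG u) ^ 2 / 2)) ∧
    ∫ u : EuclideanSpace ℝ (Fin p), (gaussNorm DV u) ^ 2 * exp (-(gaussNorm DG u) ^ 2 / 2) =
      pG * ∫ u : EuclideanSpace ℝ (Fin p), exp (-(gaussNorm DG u) ^ 2 / 2) := by
  obtain ⟨L, b, hG, hV, hb0, hb1, hs⟩ := aux_diag DG DV hDG hDV hLoewner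
  obtain ⟨K, hK, hKi, hKI⟩ := aux_change L
  rw [← hs] at hpG
  subst hpG
  have hint : Integrable (fun u : EuclideanSpace ℝ (Fin p) => exp (-(gaussNorm DG u) ^ 2 / 2)) := by
    have := hKI _ (aux_pi b hb0 hb1 one_pos).1
    simpa [hG] using this
  have hsq := aux_pi_sq b
  simp only [hG, hV] at *
  refine ⟨?_, Finset.sum_nonneg fun i _ => (hb0 i).le, hint, ?_, ?_, ?_, ?_⟩
  · intro hp
    exact Finset.sum_pos (fun i _ => hb0 i) ⟨⟨0, hp⟩, Finset.mem_univ _⟩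
  · exact integral_exp_pos hint
  · intro μ hμ
    have h := aux_pi b hb0 hb1 hμ
    refine ⟨hKI _ h.1, ?_⟩
    rw [hKi (fun v => exp (-(∑ i, v i ^ 2) / 2 + (1 - μ) * (∑ i, b i * v i ^ 2) / 2)),
      hKi (fun v => exp (-(∑ i, v i ^ 2) / 2))]
    calc _ ≤ K * _ := mul_le_mul_of_nonneg_left h.2 hK.le
      _ = _ := by ring
  · exact hKI _ hsq.1
  · rw [hKi (fun v => (∑ i, b i * v i ^ 2) * exp (-(∑ i, v i ^ 2) / 2)),
      hKi (fun v => exp (-(∑ i, v i ^ 2) / 2)), hsq.2]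
    ring

theorem aux_exp_tail {a : ℝ} (ha : 0 < a) (C t : ℝ) :
    ∫⁻ ρ in Set.Ioi t, ENNReal.ofReal (C * exp (-a * ρ)) =
      ENNReal.ofReal (C * exp (-a * t) / a) := by
  by_cases hC : 0 ≤ C
  · rw [← ofReal_integral_eq_lintegral_ofReal]
    · rw [integral_const_mul, integral_exp_mul_Ioi (by linarith)]
      congr 1
      field_simp
    · exact (integrableOn_exp_mul_Ioi (by linarith) t).const_mul C
    · exact Filter.Eventually.of_forall fun ρ => by positivity
  · push Not at hC
    rw [ENNReal.ofReal_of_nonpos]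
    · have : ∀ ρ, ENNReal.ofReal (C * exp (-a * ρ)) = 0 := fun ρ =>
        ENNReal.ofReal_of_nonpos (mul_nonpos_of_nonpos_of_nonneg hC.le (exp_pos _).le)
      simp only [this, lintegral_zero]
    · exact div_nonpos_of_nonpos_of_nonneg
        (mul_nonpos_of_nonpos_of_nonneg hC.le (exp_pos _).le) ha.le

theorem aux_numeric {d x r R ν ω : ℝ} (hd : 0 < d) (hx : 2 ≤ x) (hν0 : 0 < ν) (hν1 : ν < 1)
    (hων : ω ≤ 1 - ν) (hr : r = 2 * √d + √(2 * x)) (hR : R = r / ν) :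
    0 < R ∧ 2 * d ≤ (1 - ω) * R / 2 * R ∧
    -((1 - ω) * R / 2) * R + d / 2 + d * log R - d / 2 * log d ≤ -x - d / 2 := by
  have hsd : 0 < √d := Real.sqrt_pos.mpr hd
  have hsx : 0 < √(2 * x) := Real.sqrt_pos.mpr (by linarith)
  have hdd : √d ^ 2 = d := Real.sq_sqrt hd.le
  have hxx : √(2 * x) ^ 2 = 2 * x := Real.sq_sqrt (by linarith)
  have hr0 : 0 < r := by rw [hr]; positivity
  have hR0 : 0 < R := by rw [hR]; positivity
  have hprod := mul_pos hsd hsx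
  have hr2 : r ^ 2 = 4 * d + 4 * (√d * √(2 * x)) + 2 * x := by
    rw [hr]; linear_combination 4 * hdd + hxx
  -- with k = 1/ν
  obtain ⟨k, hk⟩ : ∃ k, k = 1 / ν := ⟨_, rfl⟩
  have hkν : k * ν = 1 := by rw [hk]; field_simp
  have hk1 : 1 ≤ k := by rw [hk, le_div_iff₀ hν0]; linarith
  have hRk : R = k * r := by rw [hR, hk]; ring
  have hak : 1 ≤ (1 - ω) * k := by nlinarith
  have hmain : k * r ^ 2 / 2 ≤ (1 - ω) * R / 2 * R := by
    rw [hRk]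
    have : 0 ≤ k * r ^ 2 := by positivity
    nlinarith
  have hkr : r ^ 2 ≤ k * r ^ 2 := by nlinarith [sq_nonneg r]
  refine ⟨hR0, by nlinarith, ?_⟩
  have hlog1 : log R = log k + log r := by
    rw [hRk, Real.log_mul (by linarith) hr0.ne']
  have hlog2 : log k ≤ k - 1 := Real.log_le_sub_one_of_pos (by linarith)
  have hlog3 : log r = log (r / √d) + log d / 2 := by
    rw [Real.log_div hr0.ne' hsd.ne', Real.log_sqrt hd.le]; ring
  have hlog4 : log (r / √d) ≤ r / √d - 1 := Real.log_le_sub_one_of_pos (by positivity)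
  have h5 : d * (r / √d) = r * √d := by
    field_simp
    exact hdd.symm
  have h6 : d * log (r / √d) ≤ r * √d - d := by nlinarith
  have h7 : r * √d = 2 * d + √d * √(2 * x) := by rw [hr]; linear_combination 2 * hdd
  have h8 : d * log k ≤ d * (k - 1) := by nlinarith
  have h9 : r ^ 2 / 2 + d * (k - 1) ≤ k * r ^ 2 / 2 := by nlinarith
  rw [hlog1, hlog3]
  nlinarith

theorem aux_measgn {p : ℕ} (D : Matrix (Fin p) (Fin p) ℝ) :
    Continuous (fun u : EuclideanSpace ℝ (Fin p) => gaussNorm D u) := by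
  unfold gaussNorm
  exact (LinearMap.continuous_of_finiteDimensional _).norm

/-- The tail integral of the majorant. -/
theorem aux_tail {p : ℕ} (DG DV : Matrix (Fin p) (Fin p) ℝ) (hDG : DG.PosDef)
    (hDV : DV.PosDef) (hLoewner : (DG * DG - DV * DV).PosSemidef) (pG : ℝ)
    (hpG : pG = ((DV * DV) * (DG * DG)⁻¹).trace) (hp : 0 < pG)
    {R c B : ℝ} (hR : 0 < R) (hc : 0 < c) (hcR : 2 * pG ≤ c * R)
    (hB : -c * R + pG / 2 + pG * log R - pG / 2 * log pG ≤ B) :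
    ∫⁻ u in {u : EuclideanSpace ℝ (Fin p) | gaussNorm DV u ≤ R}ᶜ,
      ENNReal.ofReal (exp (-c * gaussNorm DV u) *
        exp (-(gaussNorm DG u) ^ 2 / 2 + (gaussNorm DV u) ^ 2 / 2)) ≤
    ENNReal.ofReal (2 * exp B *
      ∫ u : EuclideanSpace ℝ (Fin p), exp (-(gaussNorm DG u) ^ 2 / 2)) := by
  obtain ⟨-, -, hGI, hZ, hmu, -, -⟩ := aux_gauss DG DV hDG hDV hLoewner pG hpG
  set Z := ∫ u : EuclideanSpace ℝ (Fin p), exp (-(gaussNorm DG u) ^ 2 / 2) with hZdef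
  have hmG := (aux_measgn DG).measurable
  have hmV := (aux_measgn DV).measurable
  set S : Set (EuclideanSpace ℝ (Fin p)) := {u | gaussNorm DV u ≤ R} with hS
  have hSm : MeasurableSet S := measurableSet_le hmV measurable_const
  let H : EuclideanSpace ℝ (Fin p) → ℝ → ENNReal := fun u ρ =>
    ENNReal.ofReal (c * exp (-c * ρ + pG / 2) *
      exp (-(gaussNorm DG u) ^ 2 / 2 + (1 - pG / ρ ^ 2) * (gaussNorm DV u) ^ 2 / 2))
  have hHm : Measurable (Function.uncurry H) := by
    apply ENNReal.measurable_ofReal.comp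
    have h1 : Measurable (fun q : EuclideanSpace ℝ (Fin p) × ℝ => gaussNorm DG q.1) :=
      hmG.comp measurable_fst
    have h2 : Measurable (fun q : EuclideanSpace ℝ (Fin p) × ℝ => gaussNorm DV q.1) :=
      hmV.comp measurable_fst
    fun_prop
  have step1 : ∀ u ∈ Sᶜ, ENNReal.ofReal (exp (-c * gaussNorm DV u) *
        exp (-(gaussNorm DG u) ^ 2 / 2 + (gaussNorm DV u) ^ 2 / 2)) ≤
      ∫⁻ ρ in Set.Ioi R, H u ρ := by
    intro u hu
    have hu' : R < gaussNorm DV u := by simpa [hS] using hu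
    set s := gaussNorm DV u with hs
    set E := exp (-(gaussNorm DG u) ^ 2 / 2 + s ^ 2 / 2) with hE
    calc ENNReal.ofReal (exp (-c * s) * E)
        = ENNReal.ofReal ((c * E) * exp (-c * s) / c) := by congr 1; field_simp
      _ = ∫⁻ ρ in Set.Ioi s, ENNReal.ofReal ((c * E) * exp (-c * ρ)) :=
          (aux_exp_tail hc _ _).symm
      _ ≤ ∫⁻ ρ in Set.Ioi s, H u ρ := by
          apply setLIntegral_mono' measurableSet_Ioi
          intro ρ hρ
          have hρ' : s < ρ := hρ
          apply ENNReal.ofReal_le_ofReal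
          have hs0 : 0 < s := hR.trans hu'
          have hρ0 : 0 < ρ := hs0.trans hρ'
          have h1 : pG / ρ ^ 2 * s ^ 2 ≤ pG := by
            rw [div_mul_eq_mul_div, div_le_iff₀ (by positivity)]
            have : s ^ 2 ≤ ρ ^ 2 := by nlinarith
            nlinarith
          rw [hE, mul_assoc, ← Real.exp_add, mul_assoc, ← Real.exp_add]
          apply mul_le_mul_of_nonneg_left _ hc.le
          apply Real.exp_le_exp.mpr
          rw [← hs]
          linarith
      _ ≤ _ := lintegral_mono_set (Set.Ioi_subset_Ioi hu'.le)
  calc _ ≤ ∫⁻ u in Sᶜ, ∫⁻ ρ in Set.Ioi R, H u ρ := setLIntegral_mono' hSm.compl step1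
    _ ≤ ∫⁻ u, ∫⁻ ρ in Set.Ioi R, H u ρ := setLIntegral_le_lintegral _ _
    _ = ∫⁻ ρ in Set.Ioi R, ∫⁻ u, H u ρ := lintegral_lintegral_swap hHm.aemeasurable
    _ ≤ ∫⁻ ρ in Set.Ioi R, ENNReal.ofReal
          ((c * exp (B + c / 2 * R) * Z) * exp (-(c / 2) * ρ)) := by
        apply setLIntegral_mono' measurableSet_Ioi
        intro ρ hρ
        have hρ' : R < ρ := hρ
        have hρ0 : 0 < ρ := hR.trans hρ'
        have hμ : 0 < pG / ρ ^ 2 := by positivity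
        obtain ⟨hI, hle⟩ := hmu _ hμ
        simp only [H]
        rw [← ofReal_integral_eq_lintegral_ofReal (hI.const_mul _)
          (Filter.Eventually.of_forall fun u => by positivity)]
        apply ENNReal.ofReal_le_ofReal
        rw [integral_const_mul]
        calc _ ≤ c * exp (-c * ρ + pG / 2) * ((pG / ρ ^ 2) ^ (-(pG / 2)) * Z) :=
              mul_le_mul_of_nonneg_left hle (by positivity)
          _ = c * Z * exp (-c * ρ + pG / 2 + log (pG / ρ ^ 2) * (-(pG / 2))) := by
              rw [Real.rpow_def_of_pos hμ, Real.exp_add _ (log _ * _)]; ring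
          _ ≤ c * Z * exp (B + c / 2 * R + -(c / 2) * ρ) := by
              apply mul_le_mul_of_nonneg_left _ (by positivity)
              apply Real.exp_le_exp.mpr
              rw [Real.log_div hp.ne' (by positivity), Real.log_pow]
              have h1 : log (ρ / R) ≤ ρ / R - 1 := Real.log_le_sub_one_of_pos (by positivity)
              rw [Real.log_div hρ0.ne' hR.ne'] at h1
              have h2 : pG * log ρ ≤ pG * log R + pG * (ρ / R - 1) := by nlinarith
              have h3 : pG * (ρ / R - 1) ≤ c / 2 * (ρ - R) := by
                have : pG * (ρ / R - 1) = pG / R * (ρ - R) := by field_simp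
                rw [this]
                apply mul_le_mul_of_nonneg_right _ (by linarith)
                rw [div_le_iff₀ hR]; linarith
              push_cast
              nlinarith
          _ = _ := by rw [Real.exp_add _ (-(c / 2) * ρ)]; ring
    _ = _ := by
        rw [aux_exp_tail (by positivity)]
        congr 1
        rw [Real.exp_add]
        have : exp (c / 2 * R) * exp (-(c / 2) * R) = 1 := by
          rw [← Real.exp_add, neg_mul, add_neg_cancel, Real.exp_zero]
        rw [div_eq_iff (by positivity)]
        linear_combination (c * exp B * Z) * this

theorem stmt_15 (p : ℕ)
    (DG DV : Matrix (Fin p) (Fin p) ℝ) (hDG : DG.PosDef) (hDV : DV.PosDef)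
    (hLoewner : (DG * DG - DV * DV).PosSemidef)
    (pG Z : ℝ) (hpG : pG = ((DV * DV) * (DG * DG)⁻¹).trace)
    (hZ : Z = ∫ u : EuclideanSpace ℝ (Fin p), exp (-(gaussNorm DG u) ^ 2 / 2))
    (ℓ : EuclideanSpace ℝ (Fin p) → ℝ)
    (hℓconc : ConcaveOn ℝ Set.univ ℓ) (hℓsmooth : ContDiff ℝ 2 ℓ)
    (hℓhess : ∀ u, iteratedFDeriv ℝ 2 ℓ 0 ![u, u] = -(gaussNorm DV u) ^ 2)
    (F : EuclideanSpace ℝ (Fin p) → ℝ)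
    (hF : ∀ u, F u = ℓ u - ℓ 0 - fderiv ℝ ℓ 0 u -
      (gaussNorm DG u) ^ 2 / 2 + (gaussNorm DV u) ^ 2 / 2)
    (ν xx rG : ℝ) (hν0 : 0 < ν) (hν1 : ν < 1) (hxx : 2 ≤ xx)
    (hrG : rG = 2 * Real.sqrt pG + Real.sqrt (2 * xx))
    (U : Set (EuclideanSpace ℝ (Fin p)))
    (hUdef : U = {u | gaussNorm DV u ≤ rG / ν})
    (ω : ℝ) (hω0 : 0 ≤ ω) (hων : ω ≤ min (1 / 3) (1 - ν))
    (hδ : ∀ u ∈ U,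
      |ℓ u - ℓ 0 - fderiv ℝ ℓ 0 u + (gaussNorm DV u) ^ 2 / 2| ≤
        ω * (gaussNorm DV u) ^ 2 / 2) :
    (∫ u in U, exp (F u)) ≥
        exp (-(ω * pG) / 2) * ∫ u in U, exp (-(gaussNorm DG u) ^ 2 / 2)
    ∧ (∫ u in Uᶜ, exp (F u)) / (∫ u, exp (F u)) ≤
        4 * exp (-xx - (1 - ω) * pG / 2) := by
  have hω1 : ω ≤ 1 - ν := hων.trans (min_le_right _ _)
  have hωt : ω ≤ 1 / 3 := hων.trans (min_le_left _ _)
  obtain ⟨hp1, hp0, hGI, hZ0, hmu, hsqI, hsq⟩ := aux_gauss DG DV hDG hDV hLoewner pG hpG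
  rw [← hZ] at hZ0 hsq
  have hmG := (aux_measgn DG).measurable
  have hmV := (aux_measgn DV).measurable
  have hUm : MeasurableSet U := by
    rw [hUdef]; exact measurableSet_le hmV measurable_const
  have hFc : Continuous F := by
    have h1 := hℓsmooth.continuous
    have h2 : Continuous (fun u => fderiv ℝ ℓ 0 u) := (fderiv ℝ ℓ 0).continuous
    have h3 := aux_measgn DG
    have h4 := aux_measgn DV
    have : F = fun u => ℓ u - ℓ 0 - fderiv ℝ ℓ 0 u -
      (gaussNorm DG u) ^ 2 / 2 + (gaussNorm DV u) ^ 2 / 2 := funext hF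
    rw [this]
    fun_prop
  have hrpos : 0 < rG := by
    rw [hrG]
    have : 0 < √(2 * xx) := Real.sqrt_pos.mpr (by linarith)
    positivity
  set R := rG / ν with hR
  have hRpos : 0 < R := div_pos hrpos hν0
  -- integrability of exp F on U
  have hFU : IntegrableOn (fun u => exp (F u)) U := by
    have h1 := (hmu (1 - ω) (by linarith)).1
    refine Integrable.mono' h1.integrableOn hFc.rexp.aestronglyMeasurable ?_
    refine (ae_restrict_iff' hUm).mpr (Filter.Eventually.of_forall fun u hu => ?_)
    rw [Real.norm_of_nonneg (exp_pos _).le]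
    apply Real.exp_le_exp.mpr
    have := (abs_le.mp (hδ u hu)).2
    rw [hF]
    linarith
  have hGU := hGI.integrableOn (s := U)
  have hsqU := hsqI.integrableOn (s := U)
  -- truncated second moment
  have hmom : ∫ u in U, ((gaussNorm DV u) ^ 2 * exp (-(gaussNorm DG u) ^ 2 / 2) -
      pG * exp (-(gaussNorm DG u) ^ 2 / 2)) ≤ 0 := by
    by_cases hc : R ^ 2 ≤ pG
    · apply setIntegral_nonpos hUm
      intro u hu
      rw [hUdef] at hu
      have hu' : gaussNorm DV u ≤ R := hu
      have h0 : 0 ≤ gaussNorm DV u := norm_nonneg _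
      have : gaussNorm DV u ^ 2 ≤ pG := by nlinarith
      rw [← sub_mul]
      exact mul_nonpos_of_nonpos_of_nonneg (by linarith) (exp_pos _).le
    · push Not at hc
      have hI := hsqI.sub (hGI.const_mul pG)
      have htot : ∫ u, ((gaussNorm DV u) ^ 2 * exp (-(gaussNorm DG u) ^ 2 / 2) -
          pG * exp (-(gaussNorm DG u) ^ 2 / 2)) = 0 := by
        rw [integral_sub hsqI (hGI.const_mul pG), integral_const_mul, hsq, ← hZ]; ring
      have hsplit := integral_add_compl hUm hI
      simp only [Pi.sub_apply] at hsplit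
      have hcompl : 0 ≤ ∫ u in Uᶜ, ((gaussNorm DV u) ^ 2 * exp (-(gaussNorm DG u) ^ 2 / 2) -
          pG * exp (-(gaussNorm DG u) ^ 2 / 2)) := by
        apply setIntegral_nonneg hUm.compl
        intro u hu
        rw [hUdef] at hu
        have hu' : R < gaussNorm DV u := by simpa using hu
        have : pG ≤ gaussNorm DV u ^ 2 := by nlinarith
        rw [← sub_mul]
        exact mul_nonneg (by linarith) (exp_pos _).le
      linarith
  have part1 : (∫ u in U, exp (F u)) ≥
        exp (-(ω * pG) / 2) * ∫ u in U, exp (-(gaussNorm DG u) ^ 2 / 2) := by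
    have hmomI : IntegrableOn (fun u => (gaussNorm DV u) ^ 2 * exp (-(gaussNorm DG u) ^ 2 / 2) -
          pG * exp (-(gaussNorm DG u) ^ 2 / 2)) U := hsqU.sub (hGU.const_mul pG)
    have hpt : ∀ u ∈ U, exp (-(ω * pG) / 2) * exp (-(gaussNorm DG u) ^ 2 / 2) -
        exp (-(ω * pG) / 2) * (ω / 2) *
        ((gaussNorm DV u) ^ 2 * exp (-(gaussNorm DG u) ^ 2 / 2) -
          pG * exp (-(gaussNorm DG u) ^ 2 / 2)) ≤ exp (F u) := by
      intro u hu
      have h1 := (abs_le.mp (hδ u hu)).1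
      have h2 : -(ω * pG) / 2 + -(gaussNorm DG u) ^ 2 / 2 +
          (-(ω / 2) * (gaussNorm DV u ^ 2 - pG)) ≤ F u := by
        rw [hF]; linarith
      refine le_trans ?_ (Real.exp_le_exp.mpr h2)
      rw [Real.exp_add, Real.exp_add]
      have h3 := Real.add_one_le_exp (-(ω / 2) * (gaussNorm DV u ^ 2 - pG))
      have h4 : 0 < exp (-(ω * pG) / 2) * exp (-(gaussNorm DG u) ^ 2 / 2) := by positivity
      nlinarith [mul_le_mul_of_nonneg_left h3 h4.le]
    have h := setIntegral_mono_on
      ((hGU.const_mul (exp (-(ω * pG) / 2))).sub (hmomI.const_mul (exp (-(ω * pG) / 2) * (ω / 2))))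
      hFU hUm hpt
    have e : ∫ u in U, (exp (-(ω * pG) / 2) * exp (-(gaussNorm DG u) ^ 2 / 2) -
        exp (-(ω * pG) / 2) * (ω / 2) *
        ((gaussNorm DV u) ^ 2 * exp (-(gaussNorm DG u) ^ 2 / 2) -
          pG * exp (-(gaussNorm DG u) ^ 2 / 2))) =
        exp (-(ω * pG) / 2) * (∫ u in U, exp (-(gaussNorm DG u) ^ 2 / 2)) -
        exp (-(ω * pG) / 2) * (ω / 2) *
        ∫ u in U, ((gaussNorm DV u) ^ 2 * exp (-(gaussNorm DG u) ^ 2 / 2) -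
          pG * exp (-(gaussNorm DG u) ^ 2 / 2)) := by
      rw [integral_sub (hGU.const_mul _) (hmomI.const_mul _), integral_const_mul]
      congr 1
      exact integral_const_mul _ _
    have h' := e.symm.trans_le h
    have h5 : 0 ≤ exp (-(ω * pG) / 2) * (ω / 2) := by positivity
    have h6 := mul_nonpos_of_nonneg_of_nonpos h5 hmom
    linarith
  refine ⟨part1, ?_⟩
  have hrhs : 0 ≤ 4 * exp (-xx - (1 - ω) * pG / 2) := by positivity
  by_cases hFI : Integrable (fun u => exp (F u))
  swap
  · rw [integral_undef hFI, div_zero]; exact hrhs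
  rcases Nat.eq_zero_or_pos p with hp | hp
  · subst hp
    have : Uᶜ = ∅ := by
      rw [Set.compl_empty_iff, Set.eq_univ_iff_forall]
      intro u
      rw [hUdef]
      have : gaussNorm DV u = 0 := by
        unfold gaussNorm
        rw [Subsingleton.elim ((Matrix.toEuclideanLin DV) u) 0, norm_zero]
      simp only [Set.mem_ofPred_eq, this]
      exact hRpos.le
    rw [this]
    simpa using hrhs
  have hpos := hp1 hp
  obtain ⟨-, hn1, hn2⟩ := aux_numeric hpos hxx hν0 hν1 hω1 hrG hR
  set c := (1 - ω) * R / 2 with hc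
  have hcpos : 0 < c := by
    rw [hc]
    have : 0 < 1 - ω := by linarith
    positivity
  have htail := aux_tail DG DV hDG hDV hLoewner pG hpG hpos hRpos hcpos hn1 hn2
  rw [← hUdef, ← hZ] at htail
  -- domination outside U by concavity
  have hdom : ∀ u ∈ Uᶜ, exp (F u) ≤ exp (-c * gaussNorm DV u) *
        exp (-(gaussNorm DG u) ^ 2 / 2 + (gaussNorm DV u) ^ 2 / 2) := by
    intro u hu
    rw [hUdef] at hu
    have hu' : R < gaussNorm DV u := by simpa using hu
    have hs0 : 0 < gaussNorm DV u := hRpos.trans hu'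
    set s := gaussNorm DV u with hs
    have hgn : gaussNorm DV ((R / s) • u) = R := by
      have : gaussNorm DV ((R / s) • u) = (R / s) * s := by
        rw [hs]
        unfold gaussNorm
        rw [map_smul, norm_smul, Real.norm_of_nonneg]
        have : 0 ≤ R / gaussNorm DV u := by positivity
        exact this
      rw [this]; field_simp
    have hw : (R / s) • u ∈ U := by
      rw [hUdef]; exact hgn.le
    have h1 := (abs_le.mp (hδ _ hw)).2
    rw [hgn] at h1
    have hq1 : R / s ≤ 1 := by rw [div_le_one hs0]; exact hu'.le
    have hq0 : 0 < R / s := by positivity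
    have h2 := hℓconc.2 (Set.mem_univ u) (Set.mem_univ (0 : EuclideanSpace ℝ (Fin p))) hq0.le
      (sub_nonneg.mpr hq1) (by ring)
    simp only [smul_zero, add_zero, smul_eq_mul] at h2
    rw [map_smul, smul_eq_mul] at h1
    have h3 : (R / s) * (ℓ u - ℓ 0 - fderiv ℝ ℓ 0 u) ≤ -(1 - ω) * R ^ 2 / 2 := by
      linarith
    have h4 : ℓ u - ℓ 0 - fderiv ℝ ℓ 0 u ≤ -c * s := by
      have e : -(1 - ω) * R ^ 2 / 2 = (R / s) * (-c * s) := by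
        rw [hc]; field_simp
      rw [e] at h3
      exact le_of_mul_le_mul_left h3 hq0
    rw [← Real.exp_add]
    apply Real.exp_le_exp.mpr
    rw [hF]
    linarith
  have htailF : ∫ u in Uᶜ, exp (F u) ≤ 2 * exp (-xx - pG / 2) * Z := by
    have h1 : ENNReal.ofReal (∫ u in Uᶜ, exp (F u)) ≤
        ENNReal.ofReal (2 * exp (-xx - pG / 2) * Z) := by
      rw [ofReal_integral_eq_lintegral_ofReal hFI.integrableOn
        (Filter.Eventually.of_forall fun u => (exp_pos _).le)]
      refine le_trans ?_ htail
      apply setLIntegral_mono' hUm.compl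
      intro u hu
      exact ENNReal.ofReal_le_ofReal (hdom u hu)
    exact (ENNReal.ofReal_le_ofReal_iff (by positivity)).mp h1
  -- mass of U
  have hmass : Z / 2 ≤ ∫ u in U, exp (-(gaussNorm DG u) ^ 2 / 2) := by
    have hsplit := integral_add_compl hUm hGI
    rw [← hZ] at hsplit
    have hR2 : 4 * pG ≤ R ^ 2 := by
      have h1 : 2 * √pG ≤ rG := by
        rw [hrG]; linarith [Real.sqrt_nonneg (2 * xx)]
      have h2 : rG ≤ R := by
        rw [hR, le_div_iff₀ hν0]; nlinarith
      have h3 := Real.sq_sqrt hp0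
      have h4 := Real.sqrt_nonneg pG
      nlinarith
    have hm : (4 * pG) * ∫ u in Uᶜ, exp (-(gaussNorm DG u) ^ 2 / 2) ≤ pG * Z := by
      rw [← integral_const_mul, ← hsq]
      refine le_trans ?_ (setIntegral_le_integral hsqI (s := Uᶜ)
        (Filter.Eventually.of_forall fun u => by positivity))
      apply setIntegral_mono_on (hGI.integrableOn.const_mul _) hsqI.integrableOn hUm.compl
      intro u hu
      rw [hUdef] at hu
      have hu' : R < gaussNorm DV u := by simpa using hu
      apply mul_le_mul_of_nonneg_right _ (exp_pos _).le
      nlinarith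
    have : 4 * ∫ u in Uᶜ, exp (-(gaussNorm DG u) ^ 2 / 2) ≤ Z := by
      apply le_of_mul_le_mul_left _ hpos
      linarith
    linarith
  have hden : exp (-(ω * pG) / 2) * (Z / 2) ≤ ∫ u, exp (F u) := by
    have h1 := setIntegral_le_integral hFI (s := U)
      (Filter.Eventually.of_forall fun u => (exp_pos _).le)
    have h2 := mul_le_mul_of_nonneg_left hmass (exp_pos (-(ω * pG) / 2)).le
    linarith
  have hdpos : 0 < exp (-(ω * pG) / 2) * (Z / 2) := by positivity
  rw [div_le_iff₀ (hdpos.trans_le hden)]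
  calc _ ≤ 2 * exp (-xx - pG / 2) * Z := htailF
    _ = 4 * exp (-xx - (1 - ω) * pG / 2) * (exp (-(ω * pG) / 2) * (Z / 2)) := by
      rw [show -xx - pG / 2 = (-xx - (1 - ω) * pG / 2) + (-(ω * pG) / 2) by ring, Real.exp_add]
      ring
    _ ≤ _ := mul_le_mul_of_nonneg_left hden hrhs
end

section
/- It holds that Z⁻¹ ∫_{ℝ^p} ‖D_V u‖⁶ e^{−‖D_G u‖²/2} du = (tr B)³ + 6·(tr B)·tr(B²) + 8·tr(B³) ≤ (p_G + 2)³, where B = D_V D_G⁻² D_V. (Equivalently, for a Gaussian vector γ_G ∼ N(0, D_G⁻²), E‖D_V γ_G‖⁶ ≤ (p_G + 2)³.) -/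
open MeasureTheory Real Matrix

lemma aux_int (n : ℕ) : Integrable fun x : ℝ => x ^ n * exp (-x ^ 2 / 2) := by
  have h := integrable_rpow_mul_exp_neg_mul_sq (b := 1 / 2) (by norm_num) (s := (n : ℝ))
    (by have : (0 : ℝ) ≤ n := n.cast_nonneg
        linarith)
  refine h.congr (Filter.Eventually.of_forall fun x => ?_)
  simp only [rpow_natCast]
  congr 2
  ring

noncomputable def auxM (n : ℕ) : ℝ := ∫ x : ℝ, (x ^ 2) ^ n * exp (-x ^ 2 / 2)

lemma auxM_succ (n : ℕ) : auxM (n + 1) = (2 * n + 1) * auxM n := by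
  have hd : ∀ x : ℝ, HasDerivAt (fun x : ℝ => x ^ (2 * n + 1) * exp (-x ^ 2 / 2))
      ((2 * n + 1) * ((x ^ 2) ^ n * exp (-x ^ 2 / 2)) - (x ^ 2) ^ (n + 1) * exp (-x ^ 2 / 2)) x := by
    intro x
    have h1 := hasDerivAt_pow (2 * n + 1) x
    have h2 : HasDerivAt (fun x : ℝ => exp (-x ^ 2 / 2)) (exp (-x ^ 2 / 2) * (-x)) x := by
      have := ((hasDerivAt_pow 2 x).neg.div_const 2).exp
      convert! this using 1
      simp
      ring
    convert! h1.mul h2 using 1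
    push_cast
    ring
  have i1 := aux_int (2 * n)
  have i2 := aux_int (2 * (n + 1))
  simp only [pow_mul] at i1 i2
  have h := integral_eq_zero_of_hasDerivAt_of_integrable hd ((i1.const_mul _).sub i2)
    (aux_int (2 * n + 1))
  rw [integral_sub (i1.const_mul _) i2, integral_const_mul] at h
  unfold auxM
  linarith

lemma auxM_zero_pos : 0 < auxM 0 := by
  have := integral_gaussian (1 / 2)
  have h : auxM 0 = √(π / (1 / 2)) := by
    rw [← this, auxM]
    congr 1
    ext x
    simp only [pow_zero, one_mul]
    congr 1
    ring
  rw [h]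
  positivity

noncomputable def auxN {p : ℕ} (i j k l : Fin p) : ℕ :=
  (if l = i then 1 else 0) + (if l = j then 1 else 0) + (if l = k then 1 else 0)

lemma aux_prod {p : ℕ} (i j k : Fin p) :
    ∏ l, auxM (auxN i j k l) = (∏ _l : Fin p, auxM 0) *
      (1 + 2 * ((if i = j then 1 else 0) + (if j = k then 1 else 0) + (if i = k then 1 else 0))
        + 8 * (if i = j then (if j = k then 1 else 0) else 0)) := by
  have c0 := auxM_zero_pos.ne'
  have m1 : auxM 1 = auxM 0 := by simpa using auxM_succ 0
  have m2 : auxM 2 = 3 * auxM 0 := by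
    have := auxM_succ 1
    rw [m1] at this
    norm_num at this
    exact this
  have m3 : auxM 3 = 15 * auxM 0 := by
    have := auxM_succ 2
    rw [m2] at this
    norm_num at this
    linarith
  have key : ∀ l, auxM (auxN i j k l) = auxM 0 * (auxM (auxN i j k l) / auxM 0) := by
    intro l
    field_simp
  rw [Finset.prod_congr rfl fun l _ => key l, Finset.prod_mul_distrib]
  congr 1
  have single : ∀ a : Fin p, (∀ l, l ≠ a → auxN i j k l = 0 ∨ auxN i j k l = 1) →
      ∏ l, auxM (auxN i j k l) / auxM 0 = auxM (auxN i j k a) / auxM 0 := by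
    intro a ha
    refine Finset.prod_eq_single a (fun l _ hl => ?_) (by simp)
    rcases ha l hl with h | h
    · rw [h, div_self c0]
    · rw [h, m1, div_self c0]
  by_cases hij : i = j
  · subst hij
    rw [single i (by intro l hl; simp only [auxN, hl, if_false]; split_ifs <;> simp)]
    by_cases hik : i = k
    · subst hik
      simp only [auxN, if_true]
      norm_num [m3]
      field_simp
    · simp only [auxN, if_true, hik, if_false]
      norm_num [m2]
      field_simp
  · by_cases hik : i = k
    · subst hik
      rw [single i (by intro l hl; simp only [auxN, hl, if_false]; split_ifs <;> simp)]
      have hji : ¬ j = i := fun h => hij h.symm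
      simp only [auxN, if_true, hij, hji, if_false]
      norm_num [m2]
      field_simp
    · rw [single j (by
        intro l hl
        simp only [auxN, hl, if_false]
        split_ifs with h1 h2 <;> simp
        exact hik (h1.symm.trans h2))]
      have hji : ¬ j = i := fun h => hij h.symm
      by_cases hjk : j = k
      · subst hjk
        simp only [auxN, if_true, hij, hji, if_false]
        norm_num [m2]
        field_simp
      · simp only [auxN, if_true, hij, hji, hik, hjk, if_false]
        norm_num [m1]
        exact c0

lemma aux_term {p : ℕ} (i j k : Fin p) (x : Fin p → ℝ) :
    x i ^ 2 * x j ^ 2 * x k ^ 2 * exp (-(∑ l, x l ^ 2) / 2) =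
      ∏ l, ((x l ^ 2) ^ (auxN i j k l) * exp (-x l ^ 2 / 2)) := by
  rw [Finset.prod_mul_distrib, ← exp_sum]
  congr 1
  · simp only [auxN, pow_add, Finset.prod_mul_distrib, pow_ite, pow_one, pow_zero]
    simp
  · congr 1
    rw [← Finset.sum_div, Finset.sum_neg_distrib]

lemma aux_main {p : ℕ} (d : Fin p → ℝ) :
    (∫ x : Fin p → ℝ, (∑ l, d l * x l ^ 2) ^ 3 * exp (-(∑ l, x l ^ 2) / 2)) =
      (∏ _l : Fin p, auxM 0) *
        ((∑ i, d i) ^ 3 + 6 * (∑ i, d i) * (∑ i, d i * d i) + 8 * ∑ i, d i * d i * d i) := by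
  have h1 : ∀ x : Fin p → ℝ, (∑ l, d l * x l ^ 2) ^ 3 * exp (-(∑ l, x l ^ 2) / 2) =
      ∑ i, ∑ j, ∑ k, d i * d j * d k *
        ∏ l, ((x l ^ 2) ^ (auxN i j k l) * exp (-x l ^ 2 / 2)) := by
    intro x
    simp only [← aux_term]
    rw [pow_succ, pow_two, Finset.sum_mul_sum, Finset.sum_mul, Finset.sum_mul]
    refine Finset.sum_congr rfl fun i _ => ?_
    rw [Finset.sum_mul, Finset.sum_mul]
    refine Finset.sum_congr rfl fun j _ => ?_
    rw [Finset.mul_sum, Finset.sum_mul]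
    refine Finset.sum_congr rfl fun k _ => ?_
    ring
  have hintegr : ∀ i j k : Fin p, Integrable (fun x : Fin p → ℝ => d i * d j * d k *
        ∏ l, ((x l ^ 2) ^ (auxN i j k l) * exp (-x l ^ 2 / 2))) := by
    intro i j k
    refine Integrable.const_mul ?_ _
    refine Integrable.fintype_prod (f := fun l (y : ℝ) =>
      (y ^ 2) ^ (auxN i j k l) * exp (-y ^ 2 / 2)) fun l => ?_
    have := aux_int (2 * auxN i j k l)
    simpa only [pow_mul] using this
  simp_rw [h1]
  rw [integral_finsetSum _ fun i _ => integrable_finsetSum _ fun j _ =>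
    integrable_finsetSum _ fun k _ => hintegr i j k]
  have h2 : ∀ i j k : Fin p, (∫ x : Fin p → ℝ, d i * d j * d k *
        ∏ l, ((x l ^ 2) ^ (auxN i j k l) * exp (-x l ^ 2 / 2))) =
      d i * d j * d k * ∏ l, auxM (auxN i j k l) := by
    intro i j k
    rw [integral_const_mul, integral_fintype_prod_volume_eq_prod (fun l (y : ℝ) =>
      (y ^ 2) ^ (auxN i j k l) * exp (-y ^ 2 / 2))]
    rfl
  have h3 : ∀ i, (∫ x : Fin p → ℝ, ∑ j, ∑ k, d i * d j * d k *
        ∏ l, ((x l ^ 2) ^ (auxN i j k l) * exp (-x l ^ 2 / 2))) =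
      ∑ j, ∑ k, d i * d j * d k * ∏ l, auxM (auxN i j k l) := by
    intro i
    rw [integral_finsetSum _ fun j _ => integrable_finsetSum _ fun k _ => hintegr i j k]
    refine Finset.sum_congr rfl fun j _ => ?_
    rw [integral_finsetSum _ fun k _ => hintegr i j k]
    exact Finset.sum_congr rfl fun k _ => h2 i j k
  simp_rw [h3, aux_prod]
  have h4 : ∀ i j k : Fin p, d i * d j * d k * ((∏ _l : Fin p, auxM 0) *
      (1 + 2 * ((if i = j then 1 else 0) + (if j = k then 1 else 0) + (if i = k then 1 else 0))
        + 8 * (if i = j then (if j = k then 1 else 0) else 0))) =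
      (∏ _l : Fin p, auxM 0) * (d i * d j * d k + 2 * ((if i = j then d i * d j * d k else 0) +
        (if j = k then d i * d j * d k else 0) + (if i = k then d i * d j * d k else 0))
        + 8 * (if i = j then (if j = k then d i * d j * d k else 0) else 0)) := by
    intro i j k
    split_ifs <;> ring
  simp_rw [h4, ← Finset.mul_sum]
  congr 1
  simp only [Finset.sum_add_distrib, ← Finset.mul_sum, Finset.sum_ite_irrel, Finset.sum_ite_eq,
    Finset.sum_const_zero, Finset.mem_univ, if_true]
  have e1 : ∑ i, d i * d i * ∑ k, d k = (∑ i, d i) * ∑ i, d i * d i := by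
    rw [← Finset.sum_mul, mul_comm]
  have e2 : ∑ i, ∑ j, d i * d j * d j = (∑ i, d i) * ∑ i, d i * d i := by
    rw [Finset.sum_mul_sum]
    simp only [mul_assoc]
  have e3 : ∑ i, ∑ j, d i * d j * d i = (∑ i, d i) * ∑ i, d i * d i := by
    rw [Finset.sum_mul_sum, Finset.sum_comm]
    refine Finset.sum_congr rfl fun i _ => Finset.sum_congr rfl fun j _ => by ring
  have e4 : ∑ i, (∑ j, d i * d j) * ∑ k, d k = (∑ i, d i) ^ 3 := by
    rw [← Finset.sum_mul, ← Finset.sum_mul_sum]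
    ring
  simp only [← Finset.sum_mul, e2] at e1 e3 e4 ⊢
  simp only [← Finset.mul_sum, ← Finset.sum_mul] at e1 e3 e4 ⊢
  linarith

lemma aux_main0 (p : ℕ) :
    (∫ x : Fin p → ℝ, exp (-(∑ l, x l ^ 2) / 2)) = ∏ _l : Fin p, auxM 0 := by
  have h : ∀ x : Fin p → ℝ, exp (-(∑ l, x l ^ 2) / 2) =
      ∏ l, ((x l ^ 2) ^ 0 * exp (-x l ^ 2 / 2)) := by
    intro x
    simp only [pow_zero, one_mul]
    rw [← exp_sum, ← Finset.sum_div, Finset.sum_neg_distrib]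
  simp_rw [h]
  rw [integral_fintype_prod_volume_eq_prod (fun (l : Fin p) (y : ℝ) =>
      (y ^ 2) ^ 0 * exp (-y ^ 2 / 2))]
  rfl

/-- Simultaneous diagonalization. -/
lemma aux_diag_s18 {p : ℕ} (DG DV : Matrix (Fin p) (Fin p) ℝ) (hDG : DG.PosDef) (hDV : DV.PosDef) :
    ∃ (L : Matrix (Fin p) (Fin p) ℝ) (d : Fin p → ℝ), L.det ≠ 0 ∧
      Lᵀ * (DG * DG) * L = 1 ∧ Lᵀ * (DV * DV) * L = diagonal d ∧ L * Lᵀ = (DG * DG)⁻¹ := by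
  have hu : IsUnit DG.det := hDG.det_pos.ne'.isUnit
  have sG : DGᵀ = DG := by simpa [IsHermitian] using hDG.isHermitian
  have sV : DVᵀ = DV := by simpa [IsHermitian] using hDV.isHermitian
  have sGi : (DG⁻¹)ᵀ = DG⁻¹ := by rw [transpose_nonsing_inv, sG]
  have hC : (DG⁻¹ * (DV * DV) * DG⁻¹).IsHermitian := by
    simp only [IsHermitian, conjTranspose_eq_transpose_of_trivial, transpose_mul, sGi, sV,
      Matrix.mul_assoc]
  have hspec := hC.conjStarAlgAut_star_eigenvectorUnitary
  rw [Unitary.conjStarAlgAut_star_apply] at hspec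
  obtain ⟨U, hU⟩ : ∃ U : Matrix (Fin p) (Fin p) ℝ, U = hC.eigenvectorUnitary := ⟨_, rfl⟩
  have hU1 : Uᵀ * U = 1 := by
    rw [hU]
    simpa [star_eq_conjTranspose] using Unitary.coe_star_mul_self hC.eigenvectorUnitary
  have hU2 : U * Uᵀ = 1 := mul_eq_one_comm.mp hU1
  have hs : Uᵀ * (DG⁻¹ * (DV * DV) * DG⁻¹) * U = diagonal hC.eigenvalues := by
    rw [hU]
    simpa [star_eq_conjTranspose] using hspec
  have i1 : DG⁻¹ * DG = 1 := nonsing_inv_mul _ hu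
  have i2 : DG * DG⁻¹ = 1 := mul_nonsing_inv _ hu
  refine ⟨DG⁻¹ * U, hC.eigenvalues, ?_, ?_, ?_, ?_⟩
  · have : Uᵀ * DG * (DG⁻¹ * U) = 1 := by
      rw [Matrix.mul_assoc, ← Matrix.mul_assoc DG, i2, Matrix.one_mul, hU1]
    intro h0
    have := congrArg det this
    rw [det_mul, h0] at this
    simp at this
  · rw [transpose_mul, sGi]
    calc Uᵀ * DG⁻¹ * (DG * DG) * (DG⁻¹ * U) = Uᵀ * (DG⁻¹ * DG) * (DG * DG⁻¹) * U := by
          simp only [Matrix.mul_assoc]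
      _ = 1 := by rw [i1, i2, Matrix.mul_one, Matrix.mul_one, hU1]
  · rw [transpose_mul, sGi, ← hs]
    simp only [Matrix.mul_assoc]
  · rw [transpose_mul, sGi, Matrix.mul_inv_rev]
    calc DG⁻¹ * U * (Uᵀ * DG⁻¹) = DG⁻¹ * (U * Uᵀ) * DG⁻¹ := by simp only [Matrix.mul_assoc]
      _ = _ := by rw [hU2, Matrix.mul_one]

lemma aux_norm {p : ℕ} (D L : Matrix (Fin p) (Fin p) ℝ) (hD : D.PosDef) (x : Fin p → ℝ) :
    gaussNorm D (WithLp.toLp 2 (L *ᵥ x)) ^ 2 = x ⬝ᵥ ((Lᵀ * (D * D) * L) *ᵥ x) := by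
  have s : Dᵀ = D := by simpa [IsHermitian] using hD.isHermitian
  have h : Lᵀ * (D * D) * L = (D * L)ᵀ * (D * L) := by
    rw [transpose_mul, s]
    simp only [Matrix.mul_assoc]
  rw [h, ← mulVec_mulVec, dotProduct_mulVec, vecMul_transpose, gaussNorm, EuclideanSpace.norm_sq_eq]
  simp only [toLpLin_toLp, norm_eq_abs, sq_abs, toLin'_apply, mulVec_mulVec, dotProduct]
  exact Finset.sum_congr rfl fun i _ => by ring

lemma aux_cov {p : ℕ} (L : Matrix (Fin p) (Fin p) ℝ) (hL : L.det ≠ 0)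
    (f : EuclideanSpace ℝ (Fin p) → ℝ) :
    (∫ u, f u) = |L.det| * ∫ x : Fin p → ℝ, f (WithLp.toLp 2 (L *ᵥ x)) := by
  rw [← (PiLp.volume_preserving_toLp (Fin p)).integral_comp
    (MeasurableEquiv.toLp 2 (Fin p → ℝ)).measurableEmbedding f]
  have h := Real.map_matrix_volume_pi_eq_smul_volume_pi hL
  have hemb : MeasurableEmbedding (toLin' L) := by
    have : Function.Injective (toLin' L) := by
      intro a b hab
      have hab' : L *ᵥ a = L *ᵥ b := by simpa using hab
      exact mulVec_injective_of_isUnit ((isUnit_iff_isUnit_det L).2 hL.isUnit) hab'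
    exact (LinearMap.continuous_of_finiteDimensional _).measurableEmbedding this
  have h2 := hemb.integral_map (μ := volume) (fun y : Fin p → ℝ => f (WithLp.toLp 2 y))
  rw [h, integral_smul_measure] at h2
  simp only [toLin'_apply] at h2
  rw [← h2, ENNReal.toReal_ofReal (abs_nonneg _), abs_inv, smul_eq_mul, ← mul_assoc,
    mul_inv_cancel₀ (abs_ne_zero.2 hL), one_mul]

theorem stmt_18 (p : ℕ)
    (DG DV : Matrix (Fin p) (Fin p) ℝ) (hDG : DG.PosDef) (hDV : DV.PosDef)
    (hLoewner : (DG * DG - DV * DV).PosSemidef)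
    (pG Z : ℝ) (hpG : pG = ((DV * DV) * (DG * DG)⁻¹).trace)
    (hZ : Z = ∫ u : EuclideanSpace ℝ (Fin p), exp (-(gaussNorm DG u) ^ 2 / 2))
    (B : Matrix (Fin p) (Fin p) ℝ) (hB : B = DV * (DG * DG)⁻¹ * DV) :
    Z⁻¹ * (∫ u : EuclideanSpace ℝ (Fin p),
        (gaussNorm DV u) ^ 6 * exp (-(gaussNorm DG u) ^ 2 / 2)) =
      B.trace ^ 3 + 6 * B.trace * (B * B).trace + 8 * (B * B * B).trace
    ∧ B.trace ^ 3 + 6 * B.trace * (B * B).trace + 8 * (B * B * B).trace ≤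
        (pG + 2) ^ 3 := by
  obtain ⟨L, d, hL, hG, hV, hI⟩ := aux_diag_s18 DG DV hDG hDV
  have sV : DVᵀ = DV := by simpa [IsHermitian] using hDV.isHermitian
  have t0 : ((DV * DV) * (DG * DG)⁻¹).trace = ∑ i, d i := by
    rw [← hI, ← trace_diagonal d, ← hV, ← Matrix.mul_assoc, trace_mul_comm, ← Matrix.mul_assoc]
  have t1 : B.trace = ∑ i, d i := by
    rw [← t0, hB, trace_mul_comm, Matrix.mul_assoc]
  have t2 : (B * B).trace = ∑ i, d i * d i := by
    rw [← trace_diagonal, ← diagonal_mul_diagonal, ← hV, hB, ← hI]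
    calc _ = ((DV * L) * (Lᵀ * DV * DV * L * Lᵀ * DV)).trace := by simp only [Matrix.mul_assoc]
      _ = _ := by
        rw [trace_mul_comm]
        simp only [Matrix.mul_assoc]
  have t3 : (B * B * B).trace = ∑ i, d i * d i * d i := by
    rw [← trace_diagonal, ← diagonal_mul_diagonal, ← diagonal_mul_diagonal, ← hV, hB, ← hI]
    calc _ = ((DV * L) * (Lᵀ * DV * DV * L * Lᵀ * DV * DV * L * Lᵀ * DV)).trace := by
          simp only [Matrix.mul_assoc]
      _ = _ := by
        rw [trace_mul_comm]
        simp only [Matrix.mul_assoc]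
  have nG : ∀ x, gaussNorm DG (WithLp.toLp 2 (L *ᵥ x)) ^ 2 = ∑ l, x l ^ 2 := by
    intro x
    rw [aux_norm _ _ hDG, hG, one_mulVec]
    simp only [dotProduct, sq]
  have nV : ∀ x, gaussNorm DV (WithLp.toLp 2 (L *ᵥ x)) ^ 2 = ∑ l, d l * x l ^ 2 := by
    intro x
    rw [aux_norm _ _ hDV, hV]
    simp only [dotProduct, mulVec_diagonal]
    exact Finset.sum_congr rfl fun i _ => by ring
  have nV6 : ∀ x, gaussNorm DV (WithLp.toLp 2 (L *ᵥ x)) ^ 6 = (∑ l, d l * x l ^ 2) ^ 3 := by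
    intro x
    rw [← nV, ← pow_mul]
  have hd0 : ∀ i, 0 ≤ d i := by
    intro i
    have h := aux_norm DV L hDV (Pi.single i 1)
    rw [hV] at h
    simp at h
    rw [← h]
    positivity
  have hd1 : ∀ i, d i ≤ 1 := by
    intro i
    have h := hLoewner.conjTranspose_mul_mul_same L
    rw [conjTranspose_eq_transpose_of_trivial, Matrix.mul_sub, Matrix.sub_mul, hG, hV] at h
    have := h.diag_nonneg (i := i)
    simp at this
    linarith
  constructor
  · rw [hZ, aux_cov L hL, aux_cov L hL, t1, t2, t3]
    simp only [nG, nV6]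
    rw [aux_main, aux_main0]
    have a1 : |L.det| ≠ 0 := abs_ne_zero.2 hL
    have a2 : (∏ _l : Fin p, auxM 0) ≠ 0 := Finset.prod_ne_zero_iff.2 fun _ _ => auxM_zero_pos.ne'
    field_simp
  · rw [hpG, t0, t1, t2, t3]
    have s0 : 0 ≤ ∑ i, d i := Finset.sum_nonneg fun i _ => hd0 i
    have s2 : ∑ i, d i * d i ≤ ∑ i, d i :=
      Finset.sum_le_sum fun i _ => by nlinarith [hd0 i, hd1 i]
    have s3 : ∑ i, d i * d i * d i ≤ ∑ i, d i :=
      Finset.sum_le_sum fun i _ => by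
        have h1 := hd0 i
        have h2 := hd1 i
        have h3 : d i * d i ≤ 1 := by nlinarith
        nlinarith
    nlinarith [mul_le_mul_of_nonneg_left s2 s0]
end

section
/- Fix a point x ∈ ℝ^p and suppose: (a) |m_i(x) − z_i| ≤ 1 for every i; (b) Σ_{i=1}^{n} ⟨∇m_i(x), u⟩² ≤ C_G·‖D̆u‖² for all u ∈ ℝ^p; (c) |⟨∇m_i(x), u⟩| ≤ √(C_G)·C_n·n^{−1/2}·‖D̆u‖ for all u ∈ ℝ^p and all i; (d) |⟨∇²m_i(x), u⊗u⟩| ≤ C₃·⟨∇m_i(x), u⟩² and |⟨∇³m_i(x), u⊗u⊗u⟩| ≤ C₃·|⟨∇m_i(x), u⟩|³ for all u ∈ ℝ^p and all i. Then for every u ∈ ℝ^p, the third directional derivative of ℓ satisfies |⟨∇³ℓ(x), u⊗u⊗u⟩| ≤ (4·C_G^{3/2}·C₃·C_n/√n)·‖D̆u‖³. -/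
open MeasureTheory Real Matrix

/-- Differentiating an iterated directional derivative along a line. -/
lemma hasDerivAt_line {E : Type*} [NormedAddCommGroup E] [NormedSpace ℝ E] (f : E → ℝ)
    (hf : ContDiff ℝ 3 f) (x u : E) (k : ℕ) (hk : k < 3) (t : ℝ) :
    HasDerivAt (fun s : ℝ => iteratedFDeriv ℝ k f (x + s • u) (fun _ => u))
      (iteratedFDeriv ℝ (k + 1) f (x + t • u) (fun _ => u)) t := by
  have h1 : DifferentiableAt ℝ (iteratedFDeriv ℝ k f) (x + t • u) :=
    (hf.differentiable_iteratedFDeriv (by exact_mod_cast hk)) _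
  have h2 : HasDerivAt (fun s : ℝ => x + s • u) u t := by
    simpa using ((hasDerivAt_id t).smul_const u).const_add x
  have h3 := h1.hasFDerivAt.comp_hasDerivAt t h2
  have h4 := ((ContinuousMultilinearMap.apply ℝ (fun _ : Fin k => E) ℝ
    (fun _ => u)).hasFDerivAt).comp_hasDerivAt t h3
  rw [iteratedFDeriv_succ_apply_left]
  exact h4

theorem stmt_19 (n p : ℕ) (hn : 1 ≤ n) (hp : 1 ≤ p)
    (m : Fin n → EuclideanSpace ℝ (Fin p) → ℝ)
    (hm : ∀ i, ContDiff ℝ 3 (m i))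
    (z : Fin n → ℝ)
    (ℓ : EuclideanSpace ℝ (Fin p) → ℝ)
    (hℓ : ∀ y, ℓ y = -(1 / 2) * ∑ i, (m i y - z i) ^ 2)
    (Db : Matrix (Fin p) (Fin p) ℝ) (hDb : Db.PosDef)
    (CG Cn C₃ : ℝ) (hCG : 0 < CG) (hCn : 0 < Cn) (hC₃ : 0 < C₃)
    (x : EuclideanSpace ℝ (Fin p))
    (ha : ∀ i, |m i x - z i| ≤ 1)
    (hb : ∀ u, ∑ i, (fderiv ℝ (m i) x u) ^ 2 ≤ CG * (gaussNorm Db u) ^ 2)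
    (hc : ∀ u, ∀ i, |fderiv ℝ (m i) x u| ≤
      Real.sqrt CG * Cn / Real.sqrt n * gaussNorm Db u)
    (hd2 : ∀ u, ∀ i, |iteratedFDeriv ℝ 2 (m i) x ![u, u]| ≤
      C₃ * (fderiv ℝ (m i) x u) ^ 2)
    (hd3 : ∀ u, ∀ i, |iteratedFDeriv ℝ 3 (m i) x ![u, u, u]| ≤
      C₃ * |fderiv ℝ (m i) x u| ^ 3) :
    ∀ u, |iteratedFDeriv ℝ 3 ℓ x ![u, u, u]| ≤
      4 * CG ^ ((3 : ℝ) / 2) * C₃ * Cn / Real.sqrt n * (gaussNorm Db u) ^ 3 := by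
  intro u
  have hℓ' : ℓ = fun y => -(1 / 2) * ∑ i, (m i y - z i) ^ 2 := funext hℓ
  have hℓc : ContDiff ℝ 3 ℓ := by
    rw [hℓ']
    exact contDiff_const.mul (ContDiff.sum fun i _ => ((hm i).sub contDiff_const).pow 2)
  set A : Fin n → ℕ → ℝ → ℝ := fun i k s => iteratedFDeriv ℝ k (m i) (x + s • u) (fun _ => u)
    with hA
  set B : ℕ → ℝ → ℝ := fun k s => iteratedFDeriv ℝ k ℓ (x + s • u) (fun _ => u) with hB
  have dA : ∀ i k, k < 3 → ∀ t, HasDerivAt (A i k) (A i (k + 1) t) t := fun i k hk t =>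
    hasDerivAt_line (m i) (hm i) x u k hk t
  have dB : ∀ k, k < 3 → ∀ t, HasDerivAt (B k) (B (k + 1) t) t := fun k hk t =>
    hasDerivAt_line ℓ hℓc x u k hk t
  have B0 : B 0 = fun t => -(1 / 2) * ∑ i, (A i 0 t - z i) ^ 2 := by
    funext t
    simp [hA, hB, hℓ]
  have B1 : B 1 = fun t => -∑ i, (A i 0 t - z i) * A i 1 t := by
    funext t
    refine (dB 0 (by norm_num) t).unique ?_
    rw [B0]
    have := (HasDerivAt.fun_sum (u := Finset.univ) fun i _ =>
      ((dA i 0 (by norm_num) t).sub_const (z i)).fun_pow 2).const_mul (-(1 / 2) : ℝ)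
    refine this.congr_deriv ?_
    symm
    rw [Finset.mul_sum, ← Finset.sum_neg_distrib]
    refine Finset.sum_congr rfl fun i _ => ?_
    push_cast
    ring
  have B2 : B 2 = fun t => -∑ i, (A i 1 t * A i 1 t + (A i 0 t - z i) * A i 2 t) := by
    funext t
    refine (dB 1 (by norm_num) t).unique ?_
    rw [B1]
    exact (HasDerivAt.fun_sum (u := Finset.univ) fun i _ =>
      ((dA i 0 (by norm_num) t).sub_const (z i)).fun_mul (dA i 1 (by norm_num) t)).fun_neg
  have B3 : B 3 0 = -∑ i, ((A i 2 0 * A i 1 0 + A i 1 0 * A i 2 0) +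
      (A i 1 0 * A i 2 0 + (A i 0 0 - z i) * A i 3 0)) := by
    refine (dB 2 (by norm_num) 0).unique ?_
    rw [B2]
    exact (HasDerivAt.fun_sum (u := Finset.univ) fun i _ =>
      ((dA i 1 (by norm_num) 0).fun_mul (dA i 1 (by norm_num) 0)).fun_add
      (((dA i 0 (by norm_num) 0).sub_const (z i)).fun_mul (dA i 2 (by norm_num) 0))).fun_neg
  have v3 : (![u, u, u] : Fin 3 → EuclideanSpace ℝ (Fin p)) = fun _ => u := by
    funext j; fin_cases j <;> rfl
  have v2 : (![u, u] : Fin 2 → EuclideanSpace ℝ (Fin p)) = fun _ => u := by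
    funext j; fin_cases j <;> rfl
  have eB : iteratedFDeriv ℝ 3 ℓ x ![u, u, u] = B 3 0 := by simp [hB, v3]
  have e0 : ∀ i, A i 0 0 = m i x := fun i => by simp [hA]
  have e1 : ∀ i, A i 1 0 = fderiv ℝ (m i) x u := fun i => by simp [hA]
  have e2 : ∀ i, |A i 2 0| ≤ C₃ * (fderiv ℝ (m i) x u) ^ 2 := fun i => by
    have := hd2 u i
    rw [v2] at this
    simpa [hA] using this
  have e3 : ∀ i, |A i 3 0| ≤ C₃ * |fderiv ℝ (m i) x u| ^ 3 := fun i => by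
    have := hd3 u i
    rw [v3] at this
    simpa [hA] using this
  rw [eB, B3, abs_neg]
  set K : ℝ := Real.sqrt CG * Cn / Real.sqrt n * gaussNorm Db u with hK
  have hg : 0 ≤ gaussNorm Db u := norm_nonneg _
  have hK0 : 0 ≤ K := by positivity
  have hterm : ∀ i, |(A i 2 0 * A i 1 0 + A i 1 0 * A i 2 0) +
      (A i 1 0 * A i 2 0 + (A i 0 0 - z i) * A i 3 0)| ≤
      4 * C₃ * K * (fderiv ℝ (m i) x u) ^ 2 := by
    intro i
    rw [e0, e1]
    have h1 : |fderiv ℝ (m i) x u * A i 2 0| ≤ C₃ * |fderiv ℝ (m i) x u| ^ 3 := by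
      rw [abs_mul]
      calc _ ≤ |fderiv ℝ (m i) x u| * (C₃ * (fderiv ℝ (m i) x u) ^ 2) := by
            gcongr; exact e2 i
        _ = _ := by rw [← sq_abs]; ring
    have h2 : |(m i x - z i) * A i 3 0| ≤ C₃ * |fderiv ℝ (m i) x u| ^ 3 := by
      rw [abs_mul]
      calc _ ≤ 1 * (C₃ * |fderiv ℝ (m i) x u| ^ 3) := by
            gcongr
            · exact ha i
            · exact e3 i
        _ = _ := one_mul _
    have h3 : C₃ * |fderiv ℝ (m i) x u| ^ 3 ≤ C₃ * (K * (fderiv ℝ (m i) x u) ^ 2) := by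
      have : |fderiv ℝ (m i) x u| ^ 3 = |fderiv ℝ (m i) x u| * (fderiv ℝ (m i) x u) ^ 2 := by
        rw [← sq_abs (fderiv ℝ (m i) x u)]; ring
      rw [this]
      gcongr
      exact hc u i
    rw [mul_comm (A i 2 0)]
    rw [abs_le] at h1 h2 ⊢
    constructor <;> linarith [h1.1, h1.2, h2.1, h2.2]
  have hr : CG ^ ((3 : ℝ) / 2) = CG * Real.sqrt CG := by
    rw [show (3 : ℝ) / 2 = 1 + 1 / 2 by norm_num, Real.rpow_add hCG, Real.rpow_one,
      Real.sqrt_eq_rpow]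
  calc _ ≤ ∑ i, 4 * C₃ * K * (fderiv ℝ (m i) x u) ^ 2 :=
        (Finset.abs_sum_le_sum_abs _ _).trans (Finset.sum_le_sum fun i _ => hterm i)
    _ = 4 * C₃ * K * ∑ i, (fderiv ℝ (m i) x u) ^ 2 := by rw [Finset.mul_sum]
    _ ≤ 4 * C₃ * K * (CG * (gaussNorm Db u) ^ 2) := by
        gcongr
        exact hb u
    _ = _ := by rw [hr, hK]; ring
end
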